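/- The Grigorchuk group 𝒢 acts transitively on each level of the binary rooted tree: for any two binary words w₁, w₂ of the same length there exists g ∈ 𝒢 with g(w₁) = w₂. Moreover, two infinite binary words ξ, η ∈ X^ℕ lie in the same orbit of the induced boundary action β if and only if they differ in only finitely many positions. -/

import Mathlib

/-- The Grigorchuk generator `a` on finite binary words: flips the first letter. -/
def aMap : List Bool → List Bool
  | [] => []
  | x :: w => (!x) :: w

theorem aMap_invol : ∀ w, aMap (aMap w) = w
  | [] => rfl
  | x :: w => by cases x <;> rfl

mutual
  /-- The Grigorchuk generator `b`: `b(∅)=∅`, `b(0w)=0·a(w)`, `b(1w)=1·c(w)`. -/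
  def bMap : List Bool → List Bool
    | [] => []
    | false :: w => false :: aMap w
    | true :: w => true :: cMap w
  /-- The Grigorchuk generator `c`: `c(∅)=∅`, `c(0w)=0·a(w)`, `c(1w)=1·d(w)`. -/
  def cMap : List Bool → List Bool
    | [] => []
    | false :: w => false :: aMap w
    | true :: w => true :: dMap w
  /-- The Grigorchuk generator `d`: `d(∅)=∅`, `d(0w)=0·w`, `d(1w)=1·b(w)`. -/
  def dMap : List Bool → List Bool
    | [] => []
    | false :: w => false :: w
    | true :: w => true :: bMap w
end

theorem bcd_invol : ∀ w : List Bool,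
    bMap (bMap w) = w ∧ cMap (cMap w) = w ∧ dMap (dMap w) = w := by
  intro w
  induction w with
  | nil => exact ⟨rfl, rfl, rfl⟩
  | cons x w ih =>
    cases x <;>
      simp [bMap, cMap, dMap, aMap_invol, ih.1, ih.2.1, ih.2.2]

/-- `a` as a permutation of the set of finite binary words. -/
def aPerm : Equiv.Perm (List Bool) := ⟨aMap, aMap, aMap_invol, aMap_invol⟩

/-- `b` as a permutation of the set of finite binary words. -/
def bPerm : Equiv.Perm (List Bool) :=
  ⟨bMap, bMap, fun w => (bcd_invol w).1, fun w => (bcd_invol w).1⟩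

/-- `c` as a permutation of the set of finite binary words. -/
def cPerm : Equiv.Perm (List Bool) :=
  ⟨cMap, cMap, fun w => (bcd_invol w).2.1, fun w => (bcd_invol w).2.1⟩

/-- `d` as a permutation of the set of finite binary words. -/
def dPerm : Equiv.Perm (List Bool) :=
  ⟨dMap, dMap, fun w => (bcd_invol w).2.2, fun w => (bcd_invol w).2.2⟩

/-- The Grigorchuk group: the group of bijections of `X*` generated by `a, b, c, d`. -/
def Grig : Subgroup (Equiv.Perm (List Bool)) :=
  Subgroup.closure {aPerm, bPerm, cPerm, dPerm}

/-- The length-`n` prefix of an infinite binary word `ξ : ℕ → Bool`. -/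
def pref (ξ : ℕ → Bool) (n : ℕ) : List Bool := List.ofFn fun i : Fin n => ξ i

/-- The boundary map induced by a length- and prefix-preserving map `f` of finite
words: the `n`-th letter of `f(ξ)` is the `n`-th letter of `f` applied to the
length-`(n+1)` prefix of `ξ`.  For `f ∈ 𝒢` this is the boundary action `β`. -/
def bAct (f : List Bool → List Bool) (ξ : ℕ → Bool) : ℕ → Bool :=
  fun n => (f (pref ξ (n + 1))).getD n false

/-- Prepend a letter to an infinite word. -/
def consW (x : Bool) (ξ : ℕ → Bool) : ℕ → Bool
  | 0 => x
  | n + 1 => ξ n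

theorem pref_succ (ξ : ℕ → Bool) (n : ℕ) :
    pref ξ (n + 1) = ξ 0 :: pref (fun m => ξ (m + 1)) n := by
  simp [pref, List.ofFn_succ]

theorem pref_consW (x : Bool) (ξ : ℕ → Bool) (n : ℕ) :
    pref (consW x ξ) (n + 1) = x :: pref ξ n := by
  rw [pref_succ]; rfl

theorem pref_zero (ξ : ℕ → Bool) : pref ξ 0 = [] := by simp [pref]

theorem pref_length (ξ : ℕ → Bool) (n : ℕ) : (pref ξ n).length = n := by simp [pref]

theorem pref_getD (ξ : ℕ → Bool) (n : ℕ) : (pref ξ (n + 1)).getD n false = ξ n := by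
  simp [pref, List.getD, -List.ofFn_succ]

theorem pref_add (ξ : ℕ → Bool) (N n : ℕ) :
    pref ξ (N + n) = pref ξ N ++ pref (fun m => ξ (N + m)) n := by
  simp [pref, List.ofFn_add]

/-- Eventual equality of infinite words. -/
def Cof (ξ η : ℕ → Bool) : Prop := ∃ N, ∀ n, N ≤ n → ξ n = η n

/-- `f` maps the word `ξ` to an eventually equal word. -/
def QAt (f : List Bool → List Bool) (ξ : ℕ → Bool) : Prop :=
  ∃ η, Cof ξ η ∧ ∀ n, f (pref ξ n) = pref η n

theorem QAt_a (ξ : ℕ → Bool) : QAt aMap ξ := by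
  refine ⟨consW (!ξ 0) (fun m => ξ (m + 1)), ⟨1, ?_⟩, ?_⟩
  · rintro (_ | n) hn
    · omega
    · rfl
  · rintro (_ | n)
    · simp [pref_zero, aMap]
    · rw [pref_consW, pref_succ]; rfl

theorem QAt_cons {f f' : List Bool → List Bool} {ξ : ℕ → Bool} {x : Bool} (hx : ξ 0 = x)
    (h0 : f [] = []) (hf : ∀ w, f (x :: w) = x :: f' w) (h : QAt f' (fun m => ξ (m + 1))) : QAt f ξ := by
  subst hx
  obtain ⟨η, ⟨N, hN⟩, h⟩ := h
  refine ⟨consW (ξ 0) η, ⟨N + 1, ?_⟩, ?_⟩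
  · rintro (_ | n) hn
    · omega
    · exact hN n (by omega)
  · rintro (_ | n)
    · simp [pref_zero, h0]
    · rw [pref_consW, pref_succ, hf, h]

theorem QAt_id (ξ : ℕ → Bool) : QAt (fun w => w) ξ := ⟨ξ, ⟨0, fun _ _ => rfl⟩, fun _ => rfl⟩

theorem QAt_bcd_of_false (k : ℕ) : ∀ ξ : ℕ → Bool, ξ k = false →
    QAt bMap ξ ∧ QAt cMap ξ ∧ QAt dMap ξ := by
  induction k with
  | zero =>
    intro ξ h
    refine ⟨QAt_cons (f' := aMap) h ?_ ?_ (QAt_a _), QAt_cons (f' := aMap) h ?_ ?_ (QAt_a _),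
      QAt_cons (f' := fun w => w) h ?_ ?_ (QAt_id _)⟩ <;> simp [bMap, cMap, dMap]
  | succ k ih =>
    intro ξ h
    cases h0 : ξ 0 with
    | false =>
      refine ⟨QAt_cons (f' := aMap) h0 ?_ ?_ (QAt_a _), QAt_cons (f' := aMap) h0 ?_ ?_ (QAt_a _),
        QAt_cons (f' := fun w => w) h0 ?_ ?_ (QAt_id _)⟩ <;> simp [bMap, cMap, dMap]
    | true =>
      obtain ⟨hb, hc, hd⟩ := ih (fun m => ξ (m + 1)) h
      refine ⟨QAt_cons h0 ?_ ?_ hc, QAt_cons h0 ?_ ?_ hd, QAt_cons h0 ?_ ?_ hb⟩ <;>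
        simp [bMap, cMap, dMap]

theorem bcd_true (n : ℕ) : ∀ ξ : ℕ → Bool, (∀ k, ξ k = true) →
    bMap (pref ξ n) = pref ξ n ∧ cMap (pref ξ n) = pref ξ n ∧ dMap (pref ξ n) = pref ξ n := by
  induction n with
  | zero => intro ξ _; simp [pref_zero, bMap, cMap, dMap]
  | succ n ih =>
    intro ξ h
    obtain ⟨hb, hc, hd⟩ := ih (fun m => ξ (m + 1)) (fun k => h _)
    simp [pref_succ, h 0, bMap, cMap, dMap, hb, hc, hd]

theorem QAt_bcd (ξ : ℕ → Bool) : QAt bMap ξ ∧ QAt cMap ξ ∧ QAt dMap ξ := by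
  by_cases h : ∃ k, ξ k = false
  · obtain ⟨k, hk⟩ := h
    exact QAt_bcd_of_false k ξ hk
  · have h' : ∀ k, ξ k = true := by simpa using h
    exact ⟨⟨ξ, ⟨0, fun _ _ => rfl⟩, fun n => (bcd_true n ξ h').1⟩,
      ⟨ξ, ⟨0, fun _ _ => rfl⟩, fun n => (bcd_true n ξ h').2.1⟩,
      ⟨ξ, ⟨0, fun _ _ => rfl⟩, fun n => (bcd_true n ξ h').2.2⟩⟩

theorem QAt_comp {f g : List Bool → List Bool} (hf : ∀ ξ, QAt f ξ) (hg : ∀ ξ, QAt g ξ)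
    (ξ : ℕ → Bool) : QAt (fun w => f (g w)) ξ := by
  obtain ⟨η, ⟨N, hN⟩, h⟩ := hg ξ
  obtain ⟨ζ, ⟨M, hM⟩, h'⟩ := hf η
  refine ⟨ζ, ⟨max N M, fun n hn => ?_⟩, fun n => ?_⟩
  · rw [hN n (le_trans (le_max_left _ _) hn), hM n (le_trans (le_max_right _ _) hn)]
  · simp only [h, h']

theorem QAt_grig (g : Equiv.Perm (List Bool)) (hg : g ∈ Grig) :
    (∀ ξ, QAt g ξ) ∧ (∀ ξ, QAt (g⁻¹ : Equiv.Perm (List Bool)) ξ) := by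
  unfold Grig at hg
  induction hg using Subgroup.closure_induction with
  | mem x hx =>
    rcases hx with rfl | rfl | rfl | rfl
    · exact ⟨QAt_a, QAt_a⟩
    · exact ⟨fun ξ => (QAt_bcd ξ).1, fun ξ => (QAt_bcd ξ).1⟩
    · exact ⟨fun ξ => (QAt_bcd ξ).2.1, fun ξ => (QAt_bcd ξ).2.1⟩
    · exact ⟨fun ξ => (QAt_bcd ξ).2.2, fun ξ => (QAt_bcd ξ).2.2⟩
  | one => exact ⟨QAt_id, QAt_id⟩
  | mul x y _ _ hx hy =>
    refine ⟨QAt_comp (f := ⇑x) (g := ⇑y) hx.1 hy.1, ?_⟩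
    rw [mul_inv_rev]
    exact QAt_comp (f := ⇑y⁻¹) (g := ⇑x⁻¹) hy.2 hx.2
  | inv x _ hx => exact ⟨hx.2, by rw [inv_inv]; exact hx.1⟩

theorem aPerm_mem : aPerm ∈ Grig := Subgroup.subset_closure (by simp)
theorem bPerm_mem : bPerm ∈ Grig := Subgroup.subset_closure (by simp)
theorem cPerm_mem : cPerm ∈ Grig := Subgroup.subset_closure (by simp)
theorem dPerm_mem : dPerm ∈ Grig := Subgroup.subset_closure (by simp)

/-- Self-replication at the vertex `1`. -/
theorem lift_true (h : Equiv.Perm (List Bool)) (hh : h ∈ Grig) :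
    ∃ g ∈ Grig, ∀ v, g (true :: v) = true :: h v := by
  unfold Grig at hh
  induction hh using Subgroup.closure_induction with
  | mem x hx =>
    rcases hx with rfl | rfl | rfl | rfl
    · refine ⟨aPerm * bPerm * aPerm, mul_mem (mul_mem aPerm_mem bPerm_mem) aPerm_mem,
        fun v => ?_⟩
      change aMap (bMap (aMap (true :: v))) = true :: aMap v
      simp [aMap, bMap]
    · refine ⟨dPerm, dPerm_mem, fun v => ?_⟩
      change dMap (true :: v) = true :: bMap v
      simp [dMap]
    · refine ⟨bPerm, bPerm_mem, fun v => ?_⟩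
      change bMap (true :: v) = true :: cMap v
      simp [bMap]
    · refine ⟨cPerm, cPerm_mem, fun v => ?_⟩
      change cMap (true :: v) = true :: dMap v
      simp [cMap]
  | one => exact ⟨1, one_mem _, fun v => rfl⟩
  | mul x y _ _ hx hy =>
    obtain ⟨g, hg, hgv⟩ := hx
    obtain ⟨k, hk, hkv⟩ := hy
    exact ⟨g * k, mul_mem hg hk, fun v => by simp [hgv, hkv]⟩
  | inv x _ hx =>
    obtain ⟨g, hg, hgv⟩ := hx
    refine ⟨g⁻¹, inv_mem hg, fun v => ?_⟩
    rw [Equiv.Perm.inv_eq_iff_eq, hgv]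
    simp

theorem to_true (x : Bool) : ∃ g ∈ Grig, ∀ v, g (x :: v) = true :: v := by
  cases x
  · exact ⟨aPerm, aPerm_mem, fun v => rfl⟩
  · exact ⟨1, one_mem _, fun v => rfl⟩

theorem from_true (x : Bool) : ∃ g ∈ Grig, ∀ v, g (true :: v) = x :: v := by
  cases x
  · exact ⟨aPerm, aPerm_mem, fun v => rfl⟩
  · exact ⟨1, one_mem _, fun v => rfl⟩

theorem strong_trans : ∀ w₁ w₂ : List Bool, w₁.length = w₂.length →
    ∃ g ∈ Grig, ∀ v, g (w₁ ++ v) = w₂ ++ v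
  | [], [], _ => ⟨1, one_mem _, fun v => rfl⟩
  | [], y :: w₂, h => by simp at h
  | x :: w₁, [], h => by simp at h
  | x :: w₁, y :: w₂, h => by
    obtain ⟨g, hg, hgv⟩ := strong_trans w₁ w₂ (by simpa using h)
    obtain ⟨k, hk, hkv⟩ := lift_true g hg
    obtain ⟨s, hs, hsv⟩ := to_true x
    obtain ⟨t, ht, htv⟩ := from_true y
    exact ⟨t * k * s, mul_mem (mul_mem ht hk) hs, fun v => by simp [hsv, hkv, htv, hgv]⟩

/-- The Grigorchuk group acts transitively on each level of the binary rooted tree,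
and two infinite binary words lie in the same orbit of the boundary action `β` if and
only if they differ in only finitely many positions. -/
theorem grigorchuk_level_transitive_and_orbits :
    (∀ w₁ w₂ : List Bool, w₁.length = w₂.length → ∃ g ∈ Grig, g w₁ = w₂) ∧
    (∀ ξ η : ℕ → Bool, (∃ g ∈ Grig, bAct ⇑g ξ = η) ↔ {n : ℕ | ξ n ≠ η n}.Finite) := by
  refine ⟨fun w₁ w₂ h => ?_, fun ξ η => ⟨?_, fun hfin => ?_⟩⟩
  · obtain ⟨g, hg, hgv⟩ := strong_trans w₁ w₂ h
    exact ⟨g, hg, by simpa using hgv []⟩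
  · rintro ⟨g, hg, rfl⟩
    obtain ⟨ζ, ⟨N, hN⟩, h⟩ := (QAt_grig g hg).1 ξ
    refine (Set.finite_lt_nat N).subset fun n hn => ?_
    by_contra hlt
    refine hn ?_
    rw [hN n (not_lt.mp hlt)]
    simp only [bAct, h, pref_getD]
  · obtain ⟨B, hB⟩ := hfin.bddAbove
    have hN : ∀ n, B + 1 ≤ n → ξ n = η n := by
      intro n hn
      by_contra hne
      have := hB hne
      omega
    obtain ⟨g, hg, hgv⟩ := strong_trans (pref ξ (B + 1)) (pref η (B + 1))
      (by simp [pref_length])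
    obtain ⟨ζ, -, h⟩ := (QAt_grig g hg).1 ξ
    refine ⟨g, hg, ?_⟩
    have key : ∀ n, pref ζ (B + 1 + n) = pref η (B + 1 + n) := by
      intro n
      rw [← h, pref_add ξ (B + 1) n, hgv, pref_add η (B + 1) n]
      congr 2
      funext m
      exact hN _ (by omega)
    funext n
    simp only [bAct, h, pref_getD]
    have := congrArg (fun l => l.getD n false) (key n)
    have e : n < B + 1 + n := by omega
    simpa [pref, List.getD, e] using this
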